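/- Let k ≥ 2 be a natural number, let g : ℝ → ℝ be a smooth (C^∞) function, and let D = { (x, y) ∈ ℝ² : (k−1) · y · x^{k−1} ≠ 1 }, an open subset of ℝ². Define θ : D → ℝ by θ(x, y) = g( x^{k−1} / ((k−1) · y · x^{k−1} − 1) ). Then θ is smooth on D and satisfies the partial differential equation θ_y(x, y) = x^k · θ_x(x, y) at every point (x, y) ∈ D, where θ_x and θ_y denote the partial derivatives of θ with respect to the first and second variable respectively. -/

import Mathlib

/-- For `k ≥ 2` and smooth `g : ℝ → ℝ`, the function
`θ(x, y) = g( x^{k−1} / ((k−1) y x^{k−1} − 1) )` is smooth on the open set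
`D = { (x,y) : (k−1) y x^{k−1} ≠ 1 }` and satisfies `θ_y = x^k · θ_x` on `D`. -/
theorem solution_case_beta_pow (k : ℕ) (hk : 2 ≤ k)
    (g : ℝ → ℝ) (hg : ContDiff ℝ (⊤ : ℕ∞) g)
    (D : Set (ℝ × ℝ)) (hD : D = {p : ℝ × ℝ | ((k : ℝ) - 1) * p.2 * p.1 ^ (k - 1) ≠ 1})
    (θ : ℝ × ℝ → ℝ)
    (hθ : ∀ p ∈ D, θ p = g (p.1 ^ (k - 1) / (((k : ℝ) - 1) * p.2 * p.1 ^ (k - 1) - 1))) :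
    ContDiffOn ℝ (⊤ : ℕ∞) θ D ∧
      ∀ p ∈ D, deriv (fun t => θ (p.1, t)) p.2
        = p.1 ^ k * deriv (fun t => θ (t, p.2)) p.1 := by
  subst hD
  obtain ⟨n, rfl⟩ : ∃ n, k = n + 2 := ⟨k - 2, by omega⟩
  have hn : n + 2 - 1 = n + 1 := rfl
  simp only [hn, Set.mem_ofPred_eq] at hθ ⊢
  refine ⟨?_, ?_⟩
  · refine ContDiffOn.congr (hg.comp_contDiffOn (ContDiffOn.div ?_ ?_ ?_)) hθ
    · exact (contDiff_fst.pow _).contDiffOn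
    · fun_prop
    · exact fun p hp => sub_ne_zero.2 hp
  · rintro ⟨x, y⟩ hp
    dsimp only at hp ⊢
    have hy : (fun t => θ (x, t)) =ᶠ[nhds y]
        fun t => g (x ^ (n + 1) / ((((n + 2 : ℕ) : ℝ) - 1) * t * x ^ (n + 1) - 1)) := by
      have hc : ContinuousAt (fun t : ℝ => (((n + 2 : ℕ) : ℝ) - 1) * t * x ^ (n + 1)) y := by
        fun_prop
      filter_upwards [hc.eventually_ne hp] with t ht using hθ (x, t) ht
    have hx : (fun t => θ (t, y)) =ᶠ[nhds x]
        fun t => g (t ^ (n + 1) / ((((n + 2 : ℕ) : ℝ) - 1) * y * t ^ (n + 1) - 1)) := by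
      have hc : ContinuousAt (fun t : ℝ => (((n + 2 : ℕ) : ℝ) - 1) * y * t ^ (n + 1)) x := by
        fun_prop
      filter_upwards [hc.eventually_ne hp] with t ht using hθ (t, y) ht
    have hden := sub_ne_zero.2 hp
    have hgd := (hg.differentiable (by simp)
      (x ^ (n + 1) / ((((n + 2 : ℕ) : ℝ) - 1) * y * x ^ (n + 1) - 1))).hasDerivAt
    have hdy := hgd.comp y ((hasDerivAt_const y (x ^ (n + 1))).fun_div
      ((((hasDerivAt_id' y).const_mul (((n + 2 : ℕ) : ℝ) - 1)).mul_const
        (x ^ (n + 1))).sub_const 1) hden)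
    have hdx := HasDerivAt.comp x hgd ((hasDerivAt_pow (n + 1) x).fun_div
      (((hasDerivAt_pow (n + 1) x).const_mul ((((n + 2 : ℕ) : ℝ) - 1) * y)).sub_const 1) hden)
    rw [hy.deriv_eq, hx.deriv_eq]
    refine hdy.deriv.trans (Eq.trans ?_ (congrArg _ hdx.deriv.symm))
    rw [mul_left_comm, ← mul_div_assoc]
    push_cast
    ring
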